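/- The Weyl group W_6, i.e., the subgroup of the group of ℤ-linear automorphisms of L generated by the six reflections s_0, …, s_5, is a finite group of order 51840. -/

import Mathlib

/-- The intersection form on the divisor class lattice `L = Fin 7 → ℤ`:
`⟨x, y⟩ = x₀y₀ − x₁y₁ − ⋯ − x₆y₆`. -/
def form (x y : Fin 7 → ℤ) : ℤ :=
  x 0 * y 0 - x 1 * y 1 - x 2 * y 2 - x 3 * y 3 - x 4 * y 4 - x 5 * y 5 - x 6 * y 6

/-- The standard basis vectors `e 0, …, e 6` of `L`. -/
def e (i : Fin 7) : Fin 7 → ℤ := fun j => if j = i then 1 else 0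

/-- The anticanonical class `κ = 3e₀ − e₁ − ⋯ − e₆`. -/
def kappa : Fin 7 → ℤ := (3 : ℤ) • e 0 - e 1 - e 2 - e 3 - e 4 - e 5 - e 6

/-- The simple roots `r₀ = e₀ − e₁ − e₂ − e₃` and `rᵢ = eᵢ − e_{i+1}` for `1 ≤ i ≤ 5`. -/
def r : Fin 6 → (Fin 7 → ℤ) :=
  ![e 0 - e 1 - e 2 - e 3, e 1 - e 2, e 2 - e 3, e 3 - e 4, e 4 - e 5, e 5 - e 6]

lemma form_add_left (x y v : Fin 7 → ℤ) : form (x + y) v = form x v + form y v := by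
  simp only [form, Pi.add_apply]; ring

lemma form_smul_left (c : ℤ) (x v : Fin 7 → ℤ) : form (c • x) v = c * form x v := by
  simp only [form, Pi.smul_apply, smul_eq_mul]; ring

/-- The reflection `x ↦ x + ⟨x, v⟩·v` as a ℤ-linear map. -/
def reflMap (v : Fin 7 → ℤ) : (Fin 7 → ℤ) →ₗ[ℤ] (Fin 7 → ℤ) where
  toFun x := x + form x v • v
  map_add' x y := by
    funext j
    simp only [form, Pi.add_apply, Pi.smul_apply, smul_eq_mul]
    ring
  map_smul' c x := by
    funext j
    simp only [form, Pi.add_apply, Pi.smul_apply, smul_eq_mul, RingHom.id_apply]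
    ring

lemma reflMap_invol (v : Fin 7 → ℤ) (hv : form v v = -2) (x : Fin 7 → ℤ) :
    reflMap v (reflMap v x) = x := by
  show (x + form x v • v) + form (x + form x v • v) v • v = x
  rw [form_add_left, form_smul_left, hv]
  module

/-- The reflection `sᵢ(x) = x + ⟨x, rᵢ⟩·rᵢ` through the simple root `rᵢ`,
as a ℤ-linear automorphism of `L`. -/
def s (i : Fin 6) : (Fin 7 → ℤ) ≃ₗ[ℤ] (Fin 7 → ℤ) :=
  LinearEquiv.ofLinear (reflMap (r i)) (reflMap (r i))
    (LinearMap.ext fun x => reflMap_invol (r i) (by fin_cases i <;> decide) x)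
    (LinearMap.ext fun x => reflMap_invol (r i) (by fin_cases i <;> decide) x)

/-- The Weyl group `W₆`: the subgroup of the group of ℤ-linear automorphisms of `L`
generated by the reflections `s₀, …, s₅`. -/
def W6 : Subgroup ((Fin 7 → ℤ) ≃ₗ[ℤ] (Fin 7 → ℤ)) :=
  Subgroup.closure (Set.range s)

namespace W6aux

/-- Septuples of integers, for kernel computation (the last six are negated). -/
structure T where
  a : ℤ
  b : ℤ
  c : ℤ
  d : ℤ
  p : ℤ
  q : ℤ
  t : ℤ
deriving DecidableEq

def toV (x : T) : Fin 7 → ℤ := ![x.a, -x.b, -x.c, -x.d, -x.p, -x.q, -x.t]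

lemma toV_inj : Function.Injective toV := by
  rintro ⟨a, b, c, d, p, q, t⟩ ⟨a', b', c', d', p', q', t'⟩ h
  have h0 := congrFun h 0
  have h1 := congrFun h 1
  have h2 := congrFun h 2
  have h3 := congrFun h 3
  have h4 := congrFun h 4
  have h5 := congrFun h 5
  have h6 := congrFun h 6
  simp [toV] at h0 h1 h2 h3 h4 h5 h6
  simp [*]

def act (i : Fin 6) (x : T) : T :=
  ![⟨2 * x.a - x.b - x.c - x.d, x.a - x.c - x.d, x.a - x.b - x.d, x.a - x.b - x.c, x.p, x.q, x.t⟩,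
    ⟨x.a, x.c, x.b, x.d, x.p, x.q, x.t⟩,
    ⟨x.a, x.b, x.d, x.c, x.p, x.q, x.t⟩,
    ⟨x.a, x.b, x.c, x.p, x.d, x.q, x.t⟩,
    ⟨x.a, x.b, x.c, x.d, x.q, x.p, x.t⟩,
    ⟨x.a, x.b, x.c, x.d, x.p, x.t, x.q⟩] i

lemma s_apply (i : Fin 6) (x : Fin 7 → ℤ) : s i x = x + form x (r i) • r i := rfl

lemma s_toV (i : Fin 6) (t : T) : s i (toV t) = toV (act i t) := by
  obtain ⟨a, b, c, d, p, q, t⟩ := t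
  rw [s_apply]
  funext j
  fin_cases i <;> fin_cases j <;> simp [toV, act, form, r, e] <;> ring

def ht (x : T) : ℤ :=
  - 5 * x.a + x.b + 2 * x.c + 3 * x.d + 4 * x.p + 5 * x.q + 6 * x.t

/-- The 72 solutions of `x² = 1`, `x · κ = 3`. -/
def lst : List T :=
  [⟨1,0,0,0,0,0,0⟩, ⟨2,0,0,0,1,1,1⟩, ⟨2,0,0,1,0,1,1⟩, ⟨2,0,0,1,1,0,1⟩,
   ⟨2,0,0,1,1,1,0⟩, ⟨2,0,1,0,0,1,1⟩, ⟨2,0,1,0,1,0,1⟩, ⟨2,0,1,0,1,1,0⟩,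
   ⟨2,0,1,1,0,0,1⟩, ⟨2,0,1,1,0,1,0⟩, ⟨2,0,1,1,1,0,0⟩, ⟨2,1,0,0,0,1,1⟩,
   ⟨2,1,0,0,1,0,1⟩, ⟨2,1,0,0,1,1,0⟩, ⟨2,1,0,1,0,0,1⟩, ⟨2,1,0,1,0,1,0⟩,
   ⟨2,1,0,1,1,0,0⟩, ⟨2,1,1,0,0,0,1⟩, ⟨2,1,1,0,0,1,0⟩, ⟨2,1,1,0,1,0,0⟩,
   ⟨2,1,1,1,0,0,0⟩, ⟨3,0,1,1,1,1,2⟩, ⟨3,0,1,1,1,2,1⟩, ⟨3,0,1,1,2,1,1⟩,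
   ⟨3,0,1,2,1,1,1⟩, ⟨3,0,2,1,1,1,1⟩, ⟨3,1,0,1,1,1,2⟩, ⟨3,1,0,1,1,2,1⟩,
   ⟨3,1,0,1,2,1,1⟩, ⟨3,1,0,2,1,1,1⟩, ⟨3,1,1,0,1,1,2⟩, ⟨3,1,1,0,1,2,1⟩,
   ⟨3,1,1,0,2,1,1⟩, ⟨3,1,1,1,0,1,2⟩, ⟨3,1,1,1,0,2,1⟩, ⟨3,1,1,1,1,0,2⟩,
   ⟨3,1,1,1,1,2,0⟩, ⟨3,1,1,1,2,0,1⟩, ⟨3,1,1,1,2,1,0⟩, ⟨3,1,1,2,0,1,1⟩,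
   ⟨3,1,1,2,1,0,1⟩, ⟨3,1,1,2,1,1,0⟩, ⟨3,1,2,0,1,1,1⟩, ⟨3,1,2,1,0,1,1⟩,
   ⟨3,1,2,1,1,0,1⟩, ⟨3,1,2,1,1,1,0⟩, ⟨3,2,0,1,1,1,1⟩, ⟨3,2,1,0,1,1,1⟩,
   ⟨3,2,1,1,0,1,1⟩, ⟨3,2,1,1,1,0,1⟩, ⟨3,2,1,1,1,1,0⟩, ⟨4,1,1,1,2,2,2⟩,
   ⟨4,1,1,2,1,2,2⟩, ⟨4,1,1,2,2,1,2⟩, ⟨4,1,1,2,2,2,1⟩, ⟨4,1,2,1,1,2,2⟩,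
   ⟨4,1,2,1,2,1,2⟩, ⟨4,1,2,1,2,2,1⟩, ⟨4,1,2,2,1,1,2⟩, ⟨4,1,2,2,1,2,1⟩,
   ⟨4,1,2,2,2,1,1⟩, ⟨4,2,1,1,1,2,2⟩, ⟨4,2,1,1,2,1,2⟩, ⟨4,2,1,1,2,2,1⟩,
   ⟨4,2,1,2,1,1,2⟩, ⟨4,2,1,2,1,2,1⟩, ⟨4,2,1,2,2,1,1⟩, ⟨4,2,2,1,1,1,2⟩,
   ⟨4,2,2,1,1,2,1⟩, ⟨4,2,2,1,2,1,1⟩, ⟨4,2,2,2,1,1,1⟩, ⟨5,2,2,2,2,2,2⟩]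

lemma lst_nodup : lst.Nodup := by decide +kernel
lemma lst_len : lst.length = 72 := by decide +kernel
lemma lst_act : ∀ t ∈ lst, ∀ i, act i t ∈ lst := by decide +kernel
lemma lst_desc : ∀ t ∈ lst, t = ⟨1,0,0,0,0,0,0⟩ ∨
    ∃ i, ht (act i t) < ht t := by decide +kernel
lemma lst_ht : ∀ t ∈ lst, - 5 ≤ ht t := by decide +kernel
lemma act_act (i : Fin 6) (t : T) : act i (act i t) = t := by
  obtain ⟨a, b, c, d, p, q, t⟩ := t
  fin_cases i <;> simp [act] <;> refine ⟨?_, ?_, ?_, ?_⟩ <;> ring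

lemma toV_e0 : toV ⟨1,0,0,0,0,0,0⟩ = e 0 := by decide

lemma s_mem (i : Fin 6) : s i ∈ W6 := Subgroup.subset_closure ⟨i, rfl⟩

lemma reach (n : ℕ) : ∀ t ∈ lst, ht t + 5 < n → ∃ g ∈ W6, g (e 0) = toV t := by
  induction n with
  | zero => intro t ht h; have := lst_ht t ht; simp at h; omega
  | succ n ih =>
    intro t hm h
    rcases lst_desc t hm with rfl | ⟨i, hi⟩
    · exact ⟨1, W6.one_mem, toV_e0.symm⟩
    · obtain ⟨g, hg, hgt⟩ := ih _ (lst_act t hm i) (by push_cast at h; omega)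
      refine ⟨s i * g, W6.mul_mem (s_mem i) hg, ?_⟩
      rw [LinearEquiv.mul_apply, hgt, s_toV, act_act]

/-- An induction principle: invariants of the generators. -/
lemma W6_ind {p : ((Fin 7 → ℤ) ≃ₗ[ℤ] (Fin 7 → ℤ)) → Prop} (h1 : p 1)
    (hs : ∀ i g, p g → p (s i * g)) : ∀ g ∈ W6, p g := by
  have inv : ∀ i, (s i)⁻¹ = s i := by
    intro i
    rw [inv_eq_iff_mul_eq_one]
    ext1 x
    exact (s i).apply_symm_apply x
  intro g hg
  induction hg using Subgroup.closure_induction_left with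
  | one => exact h1
  | mul_left x hx y hy ih => obtain ⟨i, rfl⟩ := hx; exact hs i y ih
  | inv_mul_cancel x hx y hy ih => obtain ⟨i, rfl⟩ := hx; rw [inv]; exact hs i y ih

lemma orbit_sub : ∀ g ∈ W6, ∃ t ∈ lst, g (e 0) = toV t := by
  apply W6_ind
  · exact ⟨⟨1,0,0,0,0,0,0⟩, by decide +kernel, toV_e0.symm⟩
  · rintro i g ⟨t, ht, h⟩
    exact ⟨act i t, lst_act t ht i, by rw [LinearEquiv.mul_apply, h, s_toV]⟩

lemma orbit_eq : MulAction.orbit W6 (e 0) = ((lst.toFinset.image toV : Finset _) : Set (Fin 7 → ℤ)) := by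
  ext x
  simp only [MulAction.mem_orbit_iff, Finset.coe_image, Set.mem_image, List.coe_toFinset,
    Set.mem_setOf_eq]
  constructor
  · rintro ⟨⟨g, hg⟩, rfl⟩
    obtain ⟨t, ht, h⟩ := orbit_sub g hg
    exact ⟨t, ht, h.symm⟩
  · rintro ⟨t, hm, rfl⟩
    obtain ⟨g, hg, h⟩ := reach (ht t + 6).toNat t hm (by have := lst_ht t hm; omega)
    exact ⟨⟨g, hg⟩, h⟩

lemma card_orbit : Nat.card (MulAction.orbit W6 (e 0)) = 72 := by
  rw [orbit_eq, Nat.card_coe_set_eq, Set.ncard_coe_finset,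
    Finset.card_image_of_injective _ toV_inj, List.toFinset_card_of_nodup lst_nodup, lst_len]

lemma form_s (i : Fin 6) (x y : Fin 7 → ℤ) : form (s i x) (s i y) = form x y := by
  rw [s_apply, s_apply]
  fin_cases i <;> simp [form, r, e] <;> ring

lemma kappa_s (i : Fin 6) (x : Fin 7 → ℤ) : form (s i x) kappa = form x kappa := by
  rw [s_apply]
  fin_cases i <;> simp [form, r, e, kappa] <;> ring

lemma form_W6 : ∀ g ∈ W6, ∀ x y, form (g x) (g y) = form x y := by
  apply W6_ind
  · intro x y; rfl
  · intro i g h x y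
    rw [LinearEquiv.mul_apply, LinearEquiv.mul_apply, form_s, h]

lemma kappa_W6 : ∀ g ∈ W6, ∀ x, form (g x) kappa = form x kappa := by
  apply W6_ind
  · intro x; rfl
  · intro i g h x
    rw [LinearEquiv.mul_apply, kappa_s, h]

/-- The symmetric group acting on the last six coordinates. -/
def P : Equiv.Perm (Fin 6) →* ((Fin 7 → ℤ) ≃ₗ[ℤ] (Fin 7 → ℤ)) where
  toFun σ :=
    { toFun := fun x => Fin.cons (x 0) (fun i => x (σ⁻¹ i).succ)
      invFun := fun x => Fin.cons (x 0) (fun i => x (σ i).succ)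
      map_add' := fun x y => by
        funext j; refine Fin.cases ?_ (fun k => ?_) j <;> simp
      map_smul' := fun c x => by
        funext j; refine Fin.cases ?_ (fun k => ?_) j <;> simp
      left_inv := fun x => by
        funext j; refine Fin.cases ?_ (fun k => ?_) j <;> simp
      right_inv := fun x => by
        funext j; refine Fin.cases ?_ (fun k => ?_) j <;> simp }
  map_one' := by
    ext1 x; funext j; refine Fin.cases ?_ (fun k => ?_) j <;> rfl
  map_mul' σ τ := by
    ext1 x; funext j; refine Fin.cases ?_ (fun k => ?_) j <;> rfl

lemma P_zero (σ : Equiv.Perm (Fin 6)) (x : Fin 7 → ℤ) : P σ x 0 = x 0 := rfl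
lemma P_succ (σ : Equiv.Perm (Fin 6)) (x : Fin 7 → ℤ) (i : Fin 6) :
    P σ x i.succ = x (σ⁻¹ i).succ := rfl

lemma P_e (σ : Equiv.Perm (Fin 6)) (i : Fin 6) : P σ (e i.succ) = e (σ i).succ := by
  funext j
  refine Fin.cases ?_ (fun k => ?_) j
  · rw [P_zero]; simp [e, (Fin.succ_ne_zero _).symm]
  · rw [P_succ]; simp [e, Equiv.symm_apply_eq]

lemma P_e0 (σ : Equiv.Perm (Fin 6)) : P σ (e 0) = e 0 := by
  funext j
  refine Fin.cases ?_ (fun k => ?_) j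
  · rw [P_zero]
  · rw [P_succ]; simp [e]

lemma e_inj : Function.Injective e := by
  intro i j h
  have := congrFun h i
  by_contra hne
  simp [e, hne] at this

lemma ext_e {g h : (Fin 7 → ℤ) ≃ₗ[ℤ] (Fin 7 → ℤ)} (H : ∀ i, g (e i) = h (e i)) : g = h := by
  apply LinearEquiv.toLinearMap_injective
  apply (Pi.basisFun ℤ (Fin 7)).ext
  intro i
  have : (Pi.basisFun ℤ (Fin 7)) i = e i := by
    funext j; simp [e, Pi.single_apply]
  rw [this]; exact H i

lemma P_swap (i : Fin 5) : P (Equiv.swap i.castSucc i.succ) = s i.succ := by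
  apply ext_e
  intro j
  revert i j
  decide +kernel

lemma P_mem (σ : Equiv.Perm (Fin 6)) : P σ ∈ W6 := by
  have h : σ ∈ Submonoid.closure
      (Set.range fun i : Fin 5 => Equiv.swap i.castSucc i.succ) := by
    rw [Equiv.Perm.mclosure_swap_castSucc_succ]; trivial
  induction h using Submonoid.closure_induction with
  | mem x hx => obtain ⟨i, rfl⟩ := hx; rw [P_swap]; exact s_mem _
  | one => rw [map_one]; exact W6.one_mem
  | mul x y _ _ hx hy => rw [map_mul]; exact W6.mul_mem hx hy

lemma unit_vec (v : Fin 7 → ℤ) (h0 : v 0 = 0) (h1 : form v v = -1) (h2 : form v kappa = 1) :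
    ∃ j : Fin 6, v = e j.succ := by
  have hk : ∑ i : Fin 6, v i.succ = 1 := by
    simp [Fin.sum_univ_succ]
    simp [form, kappa, e, h0] at h2
    linarith
  have hq : ∑ i : Fin 6, v i.succ * (v i.succ - 1) = 0 := by
    simp only [mul_sub, Finset.sum_sub_distrib, mul_one, hk]
    simp [Fin.sum_univ_succ]
    simp [form, h0] at h1
    linarith
  have hz : ∀ i : Fin 6, v i.succ = 0 ∨ v i.succ = 1 := by
    intro i
    rw [Finset.sum_eq_zero_iff_of_nonneg] at hq
    · have := hq i (Finset.mem_univ _)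
      rcases mul_eq_zero.1 this with h | h
      · exact Or.inl h
      · right; linarith
    · intro i _
      rcases le_or_gt (v i.succ) 0 with h | h
      · nlinarith
      · exact mul_nonneg h.le (by linarith [Int.add_one_le_iff.2 h])
  obtain ⟨j, hj⟩ : ∃ j : Fin 6, v j.succ = 1 := by
    by_contra! hn
    have : ∑ i : Fin 6, v i.succ = 0 :=
      Finset.sum_eq_zero fun i _ => (hz i).resolve_right (hn i)
    omega
  refine ⟨j, ?_⟩
  rw [← Finset.add_sum_erase _ _ (Finset.mem_univ j), hj] at hk
  have hr : ∑ i ∈ Finset.univ.erase j, v i.succ = 0 := by linarith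
  rw [Finset.sum_eq_zero_iff_of_nonneg (fun i _ => by rcases hz i with h | h <;> omega)] at hr
  funext k
  refine Fin.cases ?_ (fun k => ?_) k
  · simp [e, h0, (Fin.succ_ne_zero _).symm]
  · by_cases hkj : k = j
    · subst hkj; simp [e, hj]
    · rw [hr k (by simp [hkj])]; simp [e, hkj]

lemma stab_surj (g : (Fin 7 → ℤ) ≃ₗ[ℤ] (Fin 7 → ℤ)) (hg : g ∈ W6) (h0 : g (e 0) = e 0) :
    ∃ σ, P σ = g := by
  have H : ∀ i : Fin 6, ∃ j : Fin 6, g (e i.succ) = e j.succ := by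
    intro i
    apply unit_vec
    · have h := form_W6 g hg (e i.succ) (e 0)
      rw [h0] at h
      have h' : form (e i.succ) (e 0) = 0 := by clear h; revert i; decide
      rw [h'] at h
      simpa [form, e] using h
    · rw [form_W6 g hg]; revert i; decide
    · rw [kappa_W6 g hg]; revert i; decide
  choose f hf using H
  have finj : Function.Injective f := by
    intro i j hij
    have : g (e i.succ) = g (e j.succ) := by rw [hf, hf, hij]
    exact Fin.succ_injective _ (e_inj (g.injective this))
  refine ⟨Equiv.ofBijective f (Finite.injective_iff_bijective.1 finj), ?_⟩
  apply ext_e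
  intro i
  refine Fin.cases ?_ (fun k => ?_) i
  · rw [P_e0, h0]
  · rw [P_e, hf]; rfl

lemma card_stab : Nat.card (MulAction.stabilizer W6 (e 0)) = 720 := by
  have : Nat.card (Equiv.Perm (Fin 6)) = 720 := by
    rw [Nat.card_perm, Nat.card_fin]; rfl
  rw [← this]
  symm
  refine Nat.card_congr (Equiv.ofBijective (fun σ => ⟨⟨P σ, P_mem σ⟩, ?_⟩) ⟨?_, ?_⟩)
  · exact P_e0 σ
  · intro σ τ h
    have h' : P σ = P τ := congrArg (fun x => (x.1.1)) h
    ext1 i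
    have := P_e σ i
    rw [h', P_e] at this
    exact (Fin.succ_injective _ (e_inj this)).symm
  · rintro ⟨⟨g, hg⟩, h⟩
    obtain ⟨σ, rfl⟩ := stab_surj g hg h
    exact ⟨σ, rfl⟩

lemma card_W6 : Nat.card W6 = 51840 := by
  rw [← Nat.card_congr (MulAction.orbitProdStabilizerEquivGroup W6 (e 0)), Nat.card_prod,
    card_orbit, card_stab]

end W6aux

/-- The Weyl group `W₆` is a finite group of order 51840. -/
theorem statement_4 : Finite W6 ∧ Nat.card W6 = 51840 :=
  ⟨Nat.finite_of_card_ne_zero (by rw [W6aux.card_W6]; norm_num), W6aux.card_W6⟩
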